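/- arXiv:2511.07869 — 2 statements merged into one kernel-verified Lean document; each statement's English description precedes it below -/
import Mathlib

section
/- Let n ≥ 1 and let X_1, …, X_{2n} be jointly distributed random variables, each taking values in a finite set. For 0 ≤ k ≤ 2n define Q_k = Σ_{S ⊆ [2n], |S| = k} H(X_S). Then 2n·Q_n ≥ (n+1)·(Q_{n−1} + Q_{n+1}). -/
open MeasureTheory

/-- Shannon entropy (natural log) of a finitely-valued random variable `f`
on the probability space `(Ω, μ)`: `H(f) = -∑ b P(f = b) log P(f = b)`. -/
noncomputable def fentropy {Ω β : Type*} [MeasurableSpace Ω] [Fintype β]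
    (μ : Measure Ω) (f : Ω → β) : ℝ :=
  ∑ b : β, Real.negMulLog ((μ (f ⁻¹' {b})).toReal)

/-- Unnormalized subadditivity of entropy: a finite nonnegative array has entropy at most that of
its row sums plus that of its column sums, up to the entropy of its total. -/
lemma sum_negMulLog_add_negMulLog_sum_le {β γ : Type*} [Fintype β] [Fintype γ]
    (p : β → γ → ℝ) (hp : ∀ b c, 0 ≤ p b c) :
    ∑ b, ∑ c, Real.negMulLog (p b c) + Real.negMulLog (∑ b, ∑ c, p b c) ≤
      ∑ b, Real.negMulLog (∑ c, p b c) + ∑ c, Real.negMulLog (∑ b, p b c) := by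
  set r : β → ℝ := fun b => ∑ c, p b c with hr
  set s : γ → ℝ := fun c => ∑ b, p b c with hs
  set t : ℝ := ∑ b, r b with ht
  have hr0 : ∀ b, 0 ≤ r b := fun b => Finset.sum_nonneg fun c _ => hp b c
  have hs0 : ∀ c, 0 ≤ s c := fun c => Finset.sum_nonneg fun b _ => hp b c
  have ht0 : 0 ≤ t := Finset.sum_nonneg fun b _ => hr0 b
  have hst : ∑ c, s c = t := Finset.sum_comm
  have key : ∀ b c, p b c * (Real.log (r b) + Real.log (s c) - Real.log (p b c) - Real.log t) ≤
      r b * s c / t - p b c := by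
    intro b c
    rcases (hp b c).eq_or_lt with h | h
    · rw [← h]
      simpa using div_nonneg (mul_nonneg (hr0 b) (hs0 c)) ht0
    · have hrb : 0 < r b := h.trans_le
        (Finset.single_le_sum (f := p b) (fun c _ => hp b c) (Finset.mem_univ c))
      have hsc : 0 < s c := h.trans_le
        (Finset.single_le_sum (f := fun b => p b c) (fun b _ => hp b c) (Finset.mem_univ b))
      have htp : 0 < t := hrb.trans_le
        (Finset.single_le_sum (fun b _ => hr0 b) (Finset.mem_univ b))
      have hlog := Real.log_le_sub_one_of_pos (x := r b * s c / (p b c * t)) (by positivity)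
      rw [Real.log_div (by positivity) (by positivity), Real.log_mul hrb.ne' hsc.ne',
        Real.log_mul h.ne' htp.ne'] at hlog
      calc _ ≤ p b c * (r b * s c / (p b c * t) - 1) :=
            mul_le_mul_of_nonneg_left (by linarith) h.le
        _ = _ := by field_simp
  have hsum := Finset.sum_le_sum fun b (_ : b ∈ Finset.univ) =>
    Finset.sum_le_sum fun c (_ : c ∈ Finset.univ) => key b c
  have hright : ∑ b, ∑ c, (r b * s c / t - p b c) = 0 := by
    simp only [Finset.sum_sub_distrib, ← Finset.sum_div, ← Finset.mul_sum, ← Finset.sum_mul, hst]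
    change t * t / t - t = 0
    rw [mul_self_div_self, sub_self]
  have hleft : ∑ b, ∑ c, p b c *
      (Real.log (r b) + Real.log (s c) - Real.log (p b c) - Real.log t) =
      ∑ b, r b * Real.log (r b) + ∑ c, s c * Real.log (s c)
        - ∑ b, ∑ c, p b c * Real.log (p b c) - t * Real.log t := by
    simp only [mul_sub, mul_add, Finset.sum_sub_distrib, Finset.sum_add_distrib]
    rw [Finset.sum_comm (f := fun b c => p b c * Real.log (s c))]
    simp only [← Finset.sum_mul, hr, hs, ht]
  rw [hright, hleft] at hsum
  simp only [Real.negMulLog, neg_mul, Finset.sum_neg_distrib]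
  linarith

lemma measure_preimage_toReal_eq_sum {Ω β γ : Type*} [MeasurableSpace Ω] (μ : Measure Ω)
    [IsFiniteMeasure μ] [Fintype γ] (f : Ω → β) (g : Ω → γ)
    (hf : ∀ b, MeasurableSet (f ⁻¹' {b})) (hg : ∀ c, MeasurableSet (g ⁻¹' {c})) (b : β) :
    (μ (f ⁻¹' {b})).toReal = ∑ c, (μ ((fun ω => (f ω, g ω)) ⁻¹' {(b, c)})).toReal := by
  have hpre : ∀ c, (fun ω => (f ω, g ω)) ⁻¹' {(b, c)} = f ⁻¹' {b} ∩ g ⁻¹' {c} := by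
    intro c; ext ω; simp
  simp only [hpre]
  change μ.real _ = ∑ c, μ.real _
  rw [← measureReal_biUnion_finset]
  · congr 1; ext ω; simp
  · intro c _ d _ hcd
    refine Set.disjoint_left.2 fun ω h1 h2 => hcd ?_
    exact h1.2.symm.trans h2.2
  · exact fun c _ => (hf b).inter (hg c)

lemma fentropy_comp_injective {Ω β γ : Type*} [MeasurableSpace Ω] [Fintype β] [Fintype γ]
    (μ : Measure Ω) (f : Ω → β) (e : β → γ) (he : Function.Injective e) :
    fentropy μ (fun ω => e (f ω)) = fentropy μ f := by
  refine (Fintype.sum_of_injective e he _ _ (fun c hc => ?_) fun b => ?_).symm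
  · have : (fun ω => e (f ω)) ⁻¹' {c} = ∅ := by
      ext ω
      simpa using fun h => hc ⟨f ω, h⟩
    simp [this]
  · congr 3
    ext ω
    simp [he.eq_iff]

/-- Submodularity of entropy: conditional mutual information is nonnegative. -/
lemma fentropy_add_fentropy_le {Ω α β γ : Type*} [MeasurableSpace Ω] (μ : Measure Ω)
    [IsFiniteMeasure μ] [Fintype α] [Fintype β] [Fintype γ]
    (f : Ω → α) (g : Ω → β) (h : Ω → γ) (hf : ∀ a, MeasurableSet (f ⁻¹' {a}))
    (hg : ∀ b, MeasurableSet (g ⁻¹' {b})) (hh : ∀ c, MeasurableSet (h ⁻¹' {c})) :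
    fentropy μ f + fentropy μ (fun ω => ((f ω, g ω), h ω)) ≤
      fentropy μ (fun ω => (f ω, g ω)) + fentropy μ (fun ω => (f ω, h ω)) := by
  let p : α → β → γ → ℝ := fun a b c =>
    (μ ((fun ω => ((f ω, g ω), h ω)) ⁻¹' {((a, b), c)})).toReal
  have hfg : ∀ x, MeasurableSet ((fun ω => (f ω, g ω)) ⁻¹' {x}) := by
    rintro ⟨a, b⟩
    convert (hf a).inter (hg b) using 1
    ext ω; simp
  have hfh : ∀ x, MeasurableSet ((fun ω => (f ω, h ω)) ⁻¹' {x}) := by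
    rintro ⟨a, c⟩
    convert (hf a).inter (hh c) using 1
    ext ω; simp
  have pfg : ∀ a b, (μ ((fun ω => (f ω, g ω)) ⁻¹' {(a, b)})).toReal = ∑ c, p a b c :=
    fun a b => measure_preimage_toReal_eq_sum μ _ h hfg hh (a, b)
  have pfh : ∀ a c, (μ ((fun ω => (f ω, h ω)) ⁻¹' {(a, c)})).toReal = ∑ b, p a b c := by
    intro a c
    rw [measure_preimage_toReal_eq_sum μ _ g hfh hg (a, c)]
    refine Finset.sum_congr rfl fun b _ => ?_
    congr 2
    ext ω
    simp only [Set.mem_preimage, Set.mem_singleton_iff, Prod.mk.injEq]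
    tauto
  have pf : ∀ a, (μ (f ⁻¹' {a})).toReal = ∑ b, ∑ c, p a b c := by
    intro a
    rw [measure_preimage_toReal_eq_sum μ f g hf hg a]
    exact Finset.sum_congr rfl fun b _ => pfg a b
  have key := Finset.sum_le_sum fun a (_ : a ∈ Finset.univ) =>
    sum_negMulLog_add_negMulLog_sum_le (p a) fun _ _ => ENNReal.toReal_nonneg
  simp only [Finset.sum_add_distrib] at key
  simp only [fentropy, Fintype.sum_prod_type, pf, pfg, pfh]
  rw [add_comm]
  exact key

lemma fentropy_insert_eq {Ω ι : Type*} [MeasurableSpace Ω] [DecidableEq ι] (μ : Measure Ω)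
    (α : ι → Type*) [∀ i, Fintype (α i)] (X : ∀ i, Ω → α i) (S : Finset ι) (i : ι) :
    fentropy μ (fun ω (j : {j // j ∈ insert i S}) => X j.1 ω) =
      fentropy μ (fun ω => ((fun j : {j // j ∈ S} => X j.1 ω), X i ω)) := by
  let e : (∀ j : {j // j ∈ insert i S}, α j.1) → (∀ j : {j // j ∈ S}, α j.1) × α i :=
    fun x => (fun j => x ⟨j.1, Finset.mem_insert_of_mem j.2⟩, x ⟨i, Finset.mem_insert_self i S⟩)
  refine (fentropy_comp_injective μ _ e ?_).symm
  intro x y hxy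
  obtain ⟨h1, h2⟩ := Prod.mk.inj hxy
  funext ⟨j, hj⟩
  rcases Finset.mem_insert.1 hj with rfl | hj'
  · exact h2
  · exact congrFun h1 ⟨j, hj'⟩

/-- The entropy of a subfamily is a submodular function of the index set. -/
lemma fentropy_submodular {Ω ι : Type*} [MeasurableSpace Ω] [DecidableEq ι]
    (μ : Measure Ω) [IsFiniteMeasure μ] (α : ι → Type*) [∀ i, Fintype (α i)]
    [∀ i, MeasurableSpace (α i)] [∀ i, MeasurableSingletonClass (α i)]
    (X : ∀ i, Ω → α i) (hX : ∀ i, Measurable (X i)) (S : Finset ι) (i k : ι) :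
    fentropy μ (fun ω (j : {j // j ∈ S}) => X j.1 ω) +
        fentropy μ (fun ω (j : {j // j ∈ insert k (insert i S)}) => X j.1 ω) ≤
      fentropy μ (fun ω (j : {j // j ∈ insert i S}) => X j.1 ω) +
        fentropy μ (fun ω (j : {j // j ∈ insert k S}) => X j.1 ω) := by
  have hS : Measurable fun ω (j : {j // j ∈ S}) => X j.1 ω :=
    measurable_pi_lambda _ fun j => hX j.1
  have triple : fentropy μ (fun ω (j : {j // j ∈ insert k (insert i S)}) => X j.1 ω) =
      fentropy μ (fun ω => (((fun j : {j // j ∈ S} => X j.1 ω), X i ω), X k ω)) := by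
    let e : (∀ j : {j // j ∈ insert k (insert i S)}, α j.1) →
        ((∀ j : {j // j ∈ S}, α j.1) × α i) × α k :=
      fun x => ((fun j => x ⟨j.1, by simp [j.2]⟩, x ⟨i, by simp⟩), x ⟨k, by simp⟩)
    refine (fentropy_comp_injective μ _ e ?_).symm
    intro x y hxy
    obtain ⟨h12, h3⟩ := Prod.mk.inj hxy
    obtain ⟨h1, h2⟩ := Prod.mk.inj h12
    funext ⟨j, hj⟩
    rcases Finset.mem_insert.1 hj with rfl | hj'
    · exact h3
    rcases Finset.mem_insert.1 hj' with rfl | hj''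
    · exact h2
    · exact congrFun h1 ⟨j, hj''⟩
  rw [triple, fentropy_insert_eq, fentropy_insert_eq]
  exact fentropy_add_fentropy_le μ _ _ _ (fun _ => hS (measurableSet_singleton _))
    (fun _ => hX i (measurableSet_singleton _)) fun _ => hX k (measurableSet_singleton _)

lemma sum_powersetCard_sum_insert {ι : Type*} [Fintype ι] [DecidableEq ι] (h : Finset ι → ℝ)
    (k : ℕ) :
    ∑ S ∈ Finset.powersetCard k (Finset.univ : Finset ι), ∑ i ∈ Sᶜ, h (insert i S) =
      (k + 1) * ∑ T ∈ Finset.powersetCard (k + 1) (Finset.univ : Finset ι), h T := by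
  have hT : ∀ T ∈ Finset.powersetCard (k + 1) (Finset.univ : Finset ι),
      ((k : ℝ) + 1) * h T = ∑ _i ∈ T, h T := by
    intro T hT
    rw [Finset.sum_const, nsmul_eq_mul, (Finset.mem_powersetCard.1 hT).2]
    push_cast; rfl
  rw [Finset.mul_sum, Finset.sum_congr rfl hT, Finset.sum_sigma', Finset.sum_sigma']
  refine Finset.sum_bij' (fun x _ => ⟨insert x.2 x.1, x.2⟩) (fun x _ => ⟨x.1.erase x.2, x.2⟩)
    ?_ ?_ ?_ ?_ ?_
  · rintro ⟨S, i⟩ hx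
    simp only [Finset.mem_sigma, Finset.mem_powersetCard_univ, Finset.mem_compl] at hx ⊢
    exact ⟨by rw [Finset.card_insert_of_notMem hx.2, hx.1], Finset.mem_insert_self _ _⟩
  · rintro ⟨T, i⟩ hx
    simp only [Finset.mem_sigma, Finset.mem_powersetCard_univ, Finset.mem_compl] at hx ⊢
    exact ⟨by rw [Finset.card_erase_of_mem hx.2, hx.1]; rfl, Finset.notMem_erase _ _⟩
  · rintro ⟨S, i⟩ hx
    simp only [Finset.mem_sigma, Finset.mem_compl] at hx
    simp [Finset.erase_insert hx.2]
  · rintro ⟨T, i⟩ hx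
    simp only [Finset.mem_sigma] at hx
    simp [Finset.insert_erase hx.2]
  · exact fun _ _ => rfl

/-- Level sums of a submodular set function, normalized by level size, are concave. -/
lemma sum_powersetCard_concave_of_submodular {ι : Type*} [Fintype ι] [DecidableEq ι]
    (h : Finset ι → ℝ)
    (hsub : ∀ S i j, h S + h (insert j (insert i S)) ≤ h (insert i S) + h (insert j S))
    {k m : ℕ} (hcard : Fintype.card ι = k + m + 2) :
    ((m : ℝ) + 2) * (m + 1) * ∑ S ∈ Finset.powersetCard k Finset.univ, h S +
        ((k : ℝ) + 1) * (k + 2) * ∑ S ∈ Finset.powersetCard (k + 2) Finset.univ, h S ≤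
      2 * (((k : ℝ) + 1) * (m + 1) * ∑ S ∈ Finset.powersetCard (k + 1) Finset.univ, h S) := by
  have compl_card : ∀ S ∈ Finset.powersetCard k (Finset.univ : Finset ι), Sᶜ.card = m + 2 := by
    intro S hS
    rw [Finset.card_compl, (Finset.mem_powersetCard.1 hS).2]
    omega
  have erase_card : ∀ S ∈ Finset.powersetCard k (Finset.univ : Finset ι), ∀ i ∈ Sᶜ,
      (Sᶜ.erase i).card = m + 1 := by
    intro S hS i hi
    rw [Finset.card_erase_of_mem hi, compl_card S hS]
    rfl
  have sum_base : ∑ S ∈ Finset.powersetCard k Finset.univ, ∑ i ∈ Sᶜ, ∑ _j ∈ Sᶜ.erase i, h S =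
      ((m : ℝ) + 2) * (m + 1) * ∑ S ∈ Finset.powersetCard k Finset.univ, h S := by
    rw [Finset.mul_sum]
    refine Finset.sum_congr rfl fun S hS => ?_
    rw [Finset.sum_congr rfl fun i hi => by rw [Finset.sum_const, erase_card S hS i hi],
      Finset.sum_const, compl_card S hS]
    simp only [nsmul_eq_mul]
    push_cast; ring
  have sum_fst : ∑ S ∈ Finset.powersetCard k Finset.univ, ∑ i ∈ Sᶜ, ∑ _j ∈ Sᶜ.erase i,
      h (insert i S) =
      ((k : ℝ) + 1) * (m + 1) * ∑ S ∈ Finset.powersetCard (k + 1) Finset.univ, h S := by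
    rw [mul_right_comm, ← sum_powersetCard_sum_insert, Finset.sum_mul]
    refine Finset.sum_congr rfl fun S hS => ?_
    rw [Finset.sum_mul]
    refine Finset.sum_congr rfl fun i hi => ?_
    rw [Finset.sum_const, erase_card S hS i hi, nsmul_eq_mul]
    push_cast; ring
  have sum_snd : ∑ S ∈ Finset.powersetCard k Finset.univ, ∑ i ∈ Sᶜ, ∑ j ∈ Sᶜ.erase i,
      h (insert j S) =
      ((k : ℝ) + 1) * (m + 1) * ∑ S ∈ Finset.powersetCard (k + 1) Finset.univ, h S := by
    rw [← sum_fst]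
    refine Finset.sum_congr rfl fun S _ => Finset.sum_comm' fun i j => ?_
    simp only [Finset.mem_erase]
    tauto
  have sum_top : ∑ S ∈ Finset.powersetCard k Finset.univ, ∑ i ∈ Sᶜ, ∑ j ∈ Sᶜ.erase i,
      h (insert j (insert i S)) =
      ((k : ℝ) + 1) * (k + 2) * ∑ S ∈ Finset.powersetCard (k + 2) Finset.univ, h S := by
    have hstep := sum_powersetCard_sum_insert (fun T => ∑ j ∈ Tᶜ, h (insert j T)) k
    rw [sum_powersetCard_sum_insert h (k + 1)] at hstep
    simp only [Finset.compl_insert] at hstep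
    rw [hstep]
    push_cast; ring
  have key := Finset.sum_le_sum fun S (_ : S ∈ Finset.powersetCard k Finset.univ) =>
    Finset.sum_le_sum fun i (_ : i ∈ Sᶜ) =>
      Finset.sum_le_sum fun j (_ : j ∈ Sᶜ.erase i) => hsub S i j
  simp only [Finset.sum_add_distrib] at key
  rw [sum_base, sum_fst, sum_snd, sum_top] at key
  linarith

/-- With `Q k = ∑_{|S| = k} H(X_S)` over subsets `S ⊆ [2n]`, we have
`2n · Q n ≥ (n+1) · (Q (n-1) + Q (n+1))`. -/
theorem entropy_subset_sums_concave {Ω : Type*} [MeasurableSpace Ω] (μ : Measure Ω)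
    [IsProbabilityMeasure μ] {n : ℕ} (hn : 1 ≤ n)
    (α : Fin (2 * n) → Type*) [∀ i, Fintype (α i)]
    [∀ i, MeasurableSpace (α i)] [∀ i, MeasurableSingletonClass (α i)]
    (X : ∀ i, Ω → α i) (hX : ∀ i, Measurable (X i)) :
    (2 * n : ℝ) *
        (∑ S ∈ Finset.powersetCard n (Finset.univ : Finset (Fin (2 * n))),
          fentropy μ (fun ω (j : {j // j ∈ S}) => X j.1 ω)) ≥
      ((n : ℝ) + 1) *
        ((∑ S ∈ Finset.powersetCard (n - 1) (Finset.univ : Finset (Fin (2 * n))),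
            fentropy μ (fun ω (j : {j // j ∈ S}) => X j.1 ω)) +
          (∑ S ∈ Finset.powersetCard (n + 1) (Finset.univ : Finset (Fin (2 * n))),
            fentropy μ (fun ω (j : {j // j ∈ S}) => X j.1 ω))) := by
  obtain ⟨k, rfl⟩ : ∃ k, n = k + 1 := ⟨n - 1, by omega⟩
  have key := sum_powersetCard_concave_of_submodular
    (fun S => fentropy μ (fun ω (j : {j // j ∈ S}) => X j.1 ω))
    (fun S i j => fentropy_submodular μ α X hX S i j) (k := k) (m := k)
    (by rw [Fintype.card_fin]; ring)
  have hk : (0 : ℝ) < k + 1 := by positivity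
  refine le_of_mul_le_mul_left ?_ hk
  simp only [Nat.add_sub_cancel] at key ⊢
  push_cast
  linarith
end

section
/- Let n ≥ 1 and let X_1, …, X_{2n} be jointly distributed random variables, each taking values in a finite set. Let σ be a uniformly random permutation of [2n], let A_1 = {1,…,n} and A_2 = {n+1,…,2n}, and write σ(A) = {σ(i) : i ∈ A}. Then E_σ[ φ(X_{σ(A_1)}) + φ(X_{σ(A_2)} | X_{σ(A_1)}) ] ≤ (1/2)·φ(X_{[2n]}). -/
open MeasureTheory

/-- Mutual information `I(f ; g) = H(f) + H(g) - H(f, g)`. -/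
noncomputable def fmutualInfo {Ω β γ : Type*} [MeasurableSpace Ω] [Fintype β] [Fintype γ]
    (μ : Measure Ω) (f : Ω → β) (g : Ω → γ) : ℝ :=
  fentropy μ f + fentropy μ g - fentropy μ (fun ω => (f ω, g ω))

/-- Conditional mutual information
`I(f ; g | h) = H(f, h) + H(g, h) - H(f, g, h) - H(h)`. -/
noncomputable def fcondMutualInfo {Ω β γ δ : Type*} [MeasurableSpace Ω]
    [Fintype β] [Fintype γ] [Fintype δ]
    (μ : Measure Ω) (f : Ω → β) (g : Ω → γ) (h : Ω → δ) : ℝ :=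
  fentropy μ (fun ω => (f ω, h ω)) + fentropy μ (fun ω => (g ω, h ω))
    - fentropy μ (fun ω => (f ω, g ω, h ω)) - fentropy μ h

/-- The potential `φ(X_S) = ∑_{i ∈ S} I(X_i ; X_{S \ {i}})`. -/
noncomputable def fphi {Ω ι : Type*} [MeasurableSpace Ω] [DecidableEq ι]
    {α : ι → Type*} [∀ i, Fintype (α i)]
    (μ : Measure Ω) (X : ∀ i, Ω → α i) (S : Finset ι) : ℝ :=
  ∑ i ∈ S, fmutualInfo μ (X i) (fun ω (j : {j // j ∈ S.erase i}) => X j.1 ω)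

/-- The conditional potential `φ(X_S | Y) = ∑_{i ∈ S} I(X_i ; X_{S \ {i}} | Y)`. -/
noncomputable def fphiCond {Ω ι δ : Type*} [MeasurableSpace Ω] [DecidableEq ι]
    {α : ι → Type*} [∀ i, Fintype (α i)] [Fintype δ]
    (μ : Measure Ω) (X : ∀ i, Ω → α i) (S : Finset ι) (Y : Ω → δ) : ℝ :=
  ∑ i ∈ S, fcondMutualInfo μ (X i) (fun ω (j : {j // j ∈ S.erase i}) => X j.1 ω) Y

section Entropy

/-- The law of `g` is the marginal of the joint law of `(f, g)`. -/
theorem toReal_measure_preimage_eq_sum {Ω β γ : Type*} [MeasurableSpace Ω] [Fintype β]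
    [MeasurableSpace β] [MeasurableSingletonClass β] [MeasurableSpace γ]
    [MeasurableSingletonClass γ] (μ : Measure Ω) [IsFiniteMeasure μ] {f : Ω → β} {g : Ω → γ}
    (hf : Measurable f) (hg : Measurable g) (c : γ) :
    (μ (g ⁻¹' {c})).toReal = ∑ b, (μ ((fun ω => (f ω, g ω)) ⁻¹' {(b, c)})).toReal := by
  rw [← ENNReal.toReal_sum fun _ _ => measure_ne_top _ _,
    ← measure_biUnion_finset _ fun b _ => (hf.prodMk hg) (measurableSet_singleton _)]
  · congr 2
    ext ω
    simp
  · intro b _ b' _ hbb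
    refine Set.disjoint_left.2 fun ω h h' => hbb ?_
    simp only [Set.mem_preimage, Set.mem_singleton_iff, Prod.mk.injEq] at h h'
    exact h.1.symm.trans h'.1

variable {Ω β γ δ : Type*} [MeasurableSpace Ω] [Fintype β] [Fintype γ] [Fintype δ]

/-- Entropy is invariant under injective relabelling of the values. -/
theorem fentropy_comp_of_injective (μ : Measure Ω) (f : Ω → β) {e : β → γ}
    (he : Function.Injective e) : fentropy μ (fun ω => e (f ω)) = fentropy μ f := by
  classical
  unfold fentropy
  symm
  refine Finset.sum_of_injOn e he.injOn (fun _ _ => Finset.mem_coe.2 (Finset.mem_univ _)) ?_ ?_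
  · intro c _ hc
    have : (fun ω => e (f ω)) ⁻¹' {c} = ∅ := by
      ext ω
      simp only [Set.mem_preimage, Set.mem_singleton_iff, Set.mem_empty_iff_false, iff_false]
      rintro rfl
      exact hc ⟨f ω, by simp, rfl⟩
    simp [this]
  · intro b _
    congr 3
    ext ω
    simp [he.eq_iff]

/-- The discrete inequality behind submodularity of entropy. -/
theorem sum_negMulLog_submodular {p : β → γ → δ → ℝ} (hp : ∀ x y z, 0 ≤ p x y z) :
    (∑ x, ∑ y, ∑ z, Real.negMulLog (p x y z)) + ∑ z, Real.negMulLog (∑ x, ∑ y, p x y z) ≤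
      (∑ x, ∑ z, Real.negMulLog (∑ y, p x y z)) +
        ∑ y, ∑ z, Real.negMulLog (∑ x, p x y z) := by
  have key : ∀ z, (∑ x, ∑ y, Real.negMulLog (p x y z)) + Real.negMulLog (∑ x, ∑ y, p x y z) ≤
      (∑ x, Real.negMulLog (∑ y, p x y z)) + ∑ y, Real.negMulLog (∑ x, p x y z) := by
    intro z
    set u : β → ℝ := fun x => ∑ y, p x y z with hu
    set v : γ → ℝ := fun y => ∑ x, p x y z with hv
    set w : ℝ := ∑ x, u x with hw
    have hvw : ∑ y, v y = w := Finset.sum_comm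
    have hu0 : ∀ x, 0 ≤ u x := fun x => Finset.sum_nonneg fun y _ => hp x y z
    have hv0 : ∀ y, 0 ≤ v y := fun y => Finset.sum_nonneg fun x _ => hp x y z
    have hw0 : 0 ≤ w := Finset.sum_nonneg fun x _ => hu0 x
    have pointwise : ∀ x y, p x y z * Real.log (u x) + p x y z * Real.log (v y)
        - p x y z * Real.log (p x y z) - p x y z * Real.log w ≤ u x * v y / w - p x y z := by
      intro x y
      rcases (hp x y z).eq_or_lt with h | h
      · have := div_nonneg (mul_nonneg (hu0 x) (hv0 y)) hw0
        simp only [← h]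
        linarith
      · have hux : 0 < u x :=
          h.trans_le (Finset.single_le_sum (fun y _ => hp x y z) (Finset.mem_univ y))
        have hvy : 0 < v y :=
          h.trans_le (Finset.single_le_sum (fun x _ => hp x y z) (Finset.mem_univ x))
        have hwp : 0 < w :=
          hux.trans_le (Finset.single_le_sum (fun x _ => hu0 x) (Finset.mem_univ x))
        have hlog := Real.log_le_sub_one_of_pos
          (show 0 < u x * v y / (w * p x y z) by positivity)
        rw [Real.log_div (by positivity) (by positivity), Real.log_mul hux.ne' hvy.ne',
          Real.log_mul hwp.ne' h.ne'] at hlog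
        have hmul := mul_le_mul_of_nonneg_left hlog h.le
        have hcancel : p x y z * (u x * v y / (w * p x y z) - 1) = u x * v y / w - p x y z := by
          field_simp
        rw [hcancel] at hmul
        linarith
    have hsum := Finset.sum_le_sum fun x (_ : x ∈ Finset.univ) =>
      Finset.sum_le_sum fun y (_ : y ∈ Finset.univ) => pointwise x y
    have h1 : ∑ x, ∑ y, p x y z * Real.log (u x) = -∑ x, Real.negMulLog (u x) := by
      simp only [← Finset.sum_mul, Real.negMulLog, neg_mul, Finset.sum_neg_distrib, neg_neg, hu]
    have h2 : ∑ x, ∑ y, p x y z * Real.log (v y) = -∑ y, Real.negMulLog (v y) := by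
      rw [Finset.sum_comm]
      simp only [← Finset.sum_mul, Real.negMulLog, neg_mul, Finset.sum_neg_distrib, neg_neg, hv]
    have h3 : ∑ x, ∑ y, p x y z * Real.log w = -Real.negMulLog w := by
      simp only [← Finset.sum_mul, Real.negMulLog, neg_mul, neg_neg, hw, hu]
    have h4 : ∑ x, ∑ y, p x y z * Real.log (p x y z) =
        -∑ x, ∑ y, Real.negMulLog (p x y z) := by
      simp only [Real.negMulLog, neg_mul, Finset.sum_neg_distrib, neg_neg]
    have h5 : ∑ x, ∑ y, u x * v y / w = w := by
      simp only [← Finset.sum_div, ← Finset.mul_sum, hvw, ← Finset.sum_mul]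
      rw [← hw, mul_self_div_self]
    simp only [Finset.sum_sub_distrib, Finset.sum_add_distrib] at hsum
    rw [h1, h2, h3, h4, h5] at hsum
    change _ ≤ w - w at hsum
    linarith
  have total := Finset.sum_le_sum fun z (_ : z ∈ Finset.univ) => key z
  simp only [Finset.sum_add_distrib] at total
  calc _ = (∑ z, ∑ x, ∑ y, Real.negMulLog (p x y z)) +
        ∑ z, Real.negMulLog (∑ x, ∑ y, p x y z) := by
        congr 1
        rw [Finset.sum_comm]
        simp_rw [Finset.sum_comm (s := (Finset.univ : Finset δ)) (t := (Finset.univ : Finset β))]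
        rw [Finset.sum_comm]
        exact Finset.sum_congr rfl fun x _ => Finset.sum_comm
    _ ≤ _ := total
    _ = _ := by congr 1 <;> exact Finset.sum_comm

variable [MeasurableSpace β] [MeasurableSingletonClass β] [MeasurableSpace γ]
  [MeasurableSingletonClass γ] [MeasurableSpace δ] [MeasurableSingletonClass δ]

theorem fcondMutualInfo_nonneg (μ : Measure Ω) [IsFiniteMeasure μ] {f : Ω → β} {g : Ω → γ}
    {h : Ω → δ} (hf : Measurable f) (hg : Measurable g) (hh : Measurable h) :
    0 ≤ fcondMutualInfo μ f g h := by
  have sub := sum_negMulLog_submodular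
    (p := fun x y z => (μ ((fun ω => (f ω, g ω, h ω)) ⁻¹' {(x, y, z)})).toReal)
    fun _ _ _ => ENNReal.toReal_nonneg
  have hgh : ∀ y z, ∑ x, (μ ((fun ω => (f ω, g ω, h ω)) ⁻¹' {(x, y, z)})).toReal =
      (μ ((fun ω => (g ω, h ω)) ⁻¹' {(y, z)})).toReal := fun y z =>
    (toReal_measure_preimage_eq_sum μ hf (hg.prodMk hh) (y, z)).symm
  have hfh : ∀ x z, ∑ y, (μ ((fun ω => (f ω, g ω, h ω)) ⁻¹' {(x, y, z)})).toReal =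
      (μ ((fun ω => (f ω, h ω)) ⁻¹' {(x, z)})).toReal := fun x z => by
    rw [toReal_measure_preimage_eq_sum μ hg (hf.prodMk hh) (x, z)]
    refine Finset.sum_congr rfl fun y _ => ?_
    congr 2
    ext ω
    simp only [Set.mem_preimage, Set.mem_singleton_iff, Prod.mk.injEq]
    tauto
  simp only [hgh, hfh, ← toReal_measure_preimage_eq_sum μ hf hh] at sub
  simp only [fcondMutualInfo, fentropy, Fintype.sum_prod_type]
  linarith

end Entropy

section JointEntropy

variable {Ω ι : Type*} [MeasurableSpace Ω] [DecidableEq ι] {α : ι → Type*} [∀ i, Fintype (α i)]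

/-- The joint entropy of the subfamily indexed by `S`. -/
noncomputable def jointEntropy (μ : Measure Ω) (X : ∀ i, Ω → α i) (S : Finset ι) : ℝ :=
  fentropy μ (fun ω (j : {j // j ∈ S}) => X j.1 ω)

theorem fentropy_comp_eq_jointEntropy {γ : Type*} [Fintype γ] (μ : Measure Ω) (X : ∀ i, Ω → α i)
    {S : Finset ι} {e : (∀ j : {j // j ∈ S}, α j) → γ} (he : Function.Injective e) :
    fentropy μ (fun ω => e fun j => X j.1 ω) = jointEntropy μ X S :=
  fentropy_comp_of_injective μ (fun ω (j : {j // j ∈ S}) => X j.1 ω) he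

theorem fentropy_eq_jointEntropy_singleton (μ : Measure Ω) (X : ∀ i, Ω → α i) (i : ι) :
    fentropy μ (X i) = jointEntropy μ X {i} := by
  refine fentropy_comp_eq_jointEntropy μ X
    (e := fun x : (∀ j : {j // j ∈ ({i} : Finset ι)}, α j) => x ⟨i, by simp⟩) fun x y hxy => ?_
  funext ⟨j, hj⟩
  obtain rfl := Finset.mem_singleton.1 hj
  exact hxy

theorem fentropy_prod_eq_jointEntropy_union (μ : Measure Ω) (X : ∀ i, Ω → α i) (S T : Finset ι) :
    fentropy μ (fun ω => ((fun j : {j // j ∈ S} => X j.1 ω), fun j : {j // j ∈ T} => X j.1 ω)) =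
      jointEntropy μ X (S ∪ T) := by
  refine fentropy_comp_eq_jointEntropy μ X
    (e := fun x : (∀ j : {j // j ∈ S ∪ T}, α j) =>
      ((fun j : {j // j ∈ S} => x ⟨j.1, Finset.mem_union_left _ j.2⟩),
        fun j : {j // j ∈ T} => x ⟨j.1, Finset.mem_union_right _ j.2⟩)) fun x y hxy => ?_
  funext ⟨j, hj⟩
  rcases Finset.mem_union.1 hj with h | h
  · exact congrFun (congrArg Prod.fst hxy) ⟨j, h⟩
  · exact congrFun (congrArg Prod.snd hxy) ⟨j, h⟩

theorem fentropy_prod_eq_jointEntropy_insert (μ : Measure Ω) (X : ∀ i, Ω → α i) (i : ι)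
    (T : Finset ι) :
    fentropy μ (fun ω => (X i ω, fun j : {j // j ∈ T} => X j.1 ω)) =
      jointEntropy μ X (insert i T) := by
  refine fentropy_comp_eq_jointEntropy μ X
    (e := fun x : (∀ j : {j // j ∈ insert i T}, α j) =>
      (x ⟨i, Finset.mem_insert_self _ _⟩,
        fun j : {j // j ∈ T} => x ⟨j.1, Finset.mem_insert_of_mem j.2⟩)) fun x y hxy => ?_
  funext ⟨j, hj⟩
  rcases Finset.mem_insert.1 hj with rfl | h
  · exact congrArg Prod.fst hxy
  · exact congrFun (congrArg Prod.snd hxy) ⟨j, h⟩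

theorem fentropy_triple_eq_jointEntropy (μ : Measure Ω) (X : ∀ i, Ω → α i) (i : ι)
    (S T : Finset ι) :
    fentropy μ (fun ω => (X i ω, (fun j : {j // j ∈ S} => X j.1 ω),
      fun j : {j // j ∈ T} => X j.1 ω)) = jointEntropy μ X (insert i (S ∪ T)) := by
  refine fentropy_comp_eq_jointEntropy μ X
    (e := fun x : (∀ j : {j // j ∈ insert i (S ∪ T)}, α j) =>
      (x ⟨i, Finset.mem_insert_self _ _⟩,
        (fun j : {j // j ∈ S} => x ⟨j.1, Finset.mem_insert_of_mem (Finset.mem_union_left _ j.2)⟩),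
        fun j : {j // j ∈ T} => x ⟨j.1, Finset.mem_insert_of_mem (Finset.mem_union_right _ j.2)⟩))
    fun x y hxy => ?_
  funext ⟨j, hj⟩
  rcases Finset.mem_insert.1 hj with rfl | h
  · exact congrArg Prod.fst hxy
  · rcases Finset.mem_union.1 h with h | h
    · exact congrFun (congrArg (fun z => z.2.1) hxy) ⟨j, h⟩
    · exact congrFun (congrArg (fun z => z.2.2) hxy) ⟨j, h⟩

theorem fphi_eq_sum_jointEntropy (μ : Measure Ω) (X : ∀ i, Ω → α i) (S : Finset ι) :
    fphi μ X S = ∑ i ∈ S,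
      (jointEntropy μ X {i} + jointEntropy μ X (S.erase i) - jointEntropy μ X S) := by
  refine Finset.sum_congr rfl fun i hi => ?_
  rw [fmutualInfo, fentropy_eq_jointEntropy_singleton, fentropy_prod_eq_jointEntropy_insert,
    Finset.insert_erase hi, jointEntropy, jointEntropy, jointEntropy]

theorem fphiCond_eq_sum_jointEntropy (μ : Measure Ω) (X : ∀ i, Ω → α i) (S T : Finset ι) :
    fphiCond μ X S (fun ω (j : {j // j ∈ T}) => X j.1 ω) = ∑ i ∈ S,
      (jointEntropy μ X (insert i T) + jointEntropy μ X (S.erase i ∪ T)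
        - jointEntropy μ X (S ∪ T) - jointEntropy μ X T) := by
  refine Finset.sum_congr rfl fun i hi => ?_
  rw [fcondMutualInfo, fentropy_prod_eq_jointEntropy_insert, fentropy_prod_eq_jointEntropy_union,
    fentropy_triple_eq_jointEntropy, ← Finset.insert_union, Finset.insert_erase hi]
  rfl

theorem jointEntropy_submodular (μ : Measure Ω) [IsFiniteMeasure μ]
    [∀ i, MeasurableSpace (α i)] [∀ i, MeasurableSingletonClass (α i)]
    {X : ∀ i, Ω → α i} (hX : ∀ i, Measurable (X i)) (C : Finset ι) (a b : ι) :
    jointEntropy μ X C + jointEntropy μ X (insert a (insert b C)) ≤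
      jointEntropy μ X (insert a C) + jointEntropy μ X (insert b C) := by
  have hC : Measurable (fun ω (j : {j // j ∈ C}) => X j.1 ω) :=
    measurable_pi_lambda _ fun j => hX j.1
  have hb : Measurable (fun ω (j : {j // j ∈ ({b} : Finset ι)}) => X j.1 ω) :=
    measurable_pi_lambda _ fun j => hX j.1
  have h := fcondMutualInfo_nonneg μ (hX a) hb hC
  rw [fcondMutualInfo, fentropy_prod_eq_jointEntropy_insert, fentropy_prod_eq_jointEntropy_union,
    fentropy_triple_eq_jointEntropy, ← Finset.insert_eq] at h
  change 0 ≤ _ - jointEntropy μ X C at h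
  linarith

end JointEntropy

section Permutations

open Equiv

variable {ι : Type*} [DecidableEq ι]

theorem image_mul_swap {A : Finset ι} {a b : ι} (ha : a ∈ A) (hb : b ∉ A) (σ : Perm ι) :
    A.image (σ * swap a b) = insert (σ b) ((A.image σ).erase (σ a)) := by
  ext x
  obtain ⟨y, rfl⟩ := σ.surjective x
  simp only [Finset.mem_image, Finset.mem_insert, Finset.mem_erase, Perm.mul_apply,
    EmbeddingLike.apply_eq_iff_eq, exists_eq_right, ne_eq]
  constructor
  · rintro ⟨z, hz, rfl⟩
    rcases eq_or_ne z a with rfl | hza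
    · simp
    · have hzb : z ≠ b := by rintro rfl; exact hb hz
      rw [swap_apply_of_ne_of_ne hza hzb]
      exact Or.inr ⟨hza, hz⟩
  · rintro (rfl | ⟨hya, hy⟩)
    · exact ⟨a, ha, swap_apply_left _ _⟩
    · exact ⟨y, hy, swap_apply_of_ne_of_ne hya (by rintro rfl; exact hb hy)⟩

variable [Fintype ι]

theorem sum_perm_mul_swap (F : Perm ι → ℝ) (a b : ι) :
    ∑ σ : Perm ι, F (σ * swap a b) = ∑ σ, F σ :=
  Equiv.sum_comp (Equiv.mulRight (swap a b)) F

/-- Exchanging an element of `A` with one outside `A` shows that the average of a submodular set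
function over random sets is concave in their size. -/
theorem sum_perm_concave {h : Finset ι → ℝ}
    (hsub : ∀ C a b, h C + h (insert a (insert b C)) ≤ h (insert a C) + h (insert b C))
    {A : Finset ι} {a b : ι} (ha : a ∈ A) (hb : b ∉ A) :
    ∑ σ : Perm ι, (h ((A.image σ).erase (σ a)) + h (insert (σ b) (A.image σ))) ≤
      2 * ∑ σ : Perm ι, h (A.image σ) := by
  rw [two_mul]
  nth_rewrite 2 [← sum_perm_mul_swap _ a b]
  rw [← Finset.sum_add_distrib]
  refine Finset.sum_le_sum fun σ _ => ?_
  have hs := hsub ((A.image σ).erase (σ a)) (σ a) (σ b)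
  rw [Finset.insert_comm, Finset.insert_erase (Finset.mem_image_of_mem σ ha),
    ← image_mul_swap ha hb] at hs
  linarith

theorem sum_perm_apply_eq (g : ι → ℝ) (a b : ι) :
    ∑ σ : Perm ι, g (σ a) = ∑ σ : Perm ι, g (σ b) := by
  rw [← sum_perm_mul_swap (fun σ => g (σ a)) a b]
  simp

end Permutations

theorem sum_filter_le_eq_sum_filter_lt_rev {n : ℕ} (F : Fin (2 * n) → ℝ) :
    ∑ i : Fin (2 * n) with n ≤ i.val, F i = ∑ i : Fin (2 * n) with i.val < n, F i.rev := by
  refine (Finset.sum_equiv Fin.revPerm (fun i => ?_) fun i _ => rfl).symm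
  have := i.2
  simp only [Finset.mem_filter, Finset.mem_univ, true_and, Fin.revPerm_apply, Fin.val_rev]
  omega

/-- The sum over permutations, restricted to the first half of the indices, is half of the
full sum. -/
theorem sum_perm_sum_filter_lt {n : ℕ} (g : Fin (2 * n) → ℝ) :
    ∑ i : Fin (2 * n) with i.val < n, ∑ σ : Equiv.Perm (Fin (2 * n)), g (σ i) =
      (1 / 2) * (Fintype.card (Equiv.Perm (Fin (2 * n))) * ∑ i, g i) := by
  have htot : ∑ i, ∑ σ : Equiv.Perm (Fin (2 * n)), g (σ i) =
      Fintype.card (Equiv.Perm (Fin (2 * n))) * ∑ i, g i := by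
    rw [Finset.sum_comm]
    simp [Equiv.sum_comp]
  rw [← htot, ← Finset.sum_filter_add_sum_filter_not Finset.univ
    (fun i : Fin (2 * n) => (i : ℕ) < n)]
  simp only [not_lt]
  rw [sum_filter_le_eq_sum_filter_lt_rev]
  simp only [fun i : Fin (2 * n) => sum_perm_apply_eq g i.rev i]
  ring

/-- new pinning lemma, two blocks. For a uniformly random permutation `σ`
of `[2n]`, with `A₁ = {1,…,n}` and `A₂ = {n+1,…,2n}`,
`E_σ[ φ(X_{σ(A₁)}) + φ(X_{σ(A₂)} | X_{σ(A₁)}) ] ≤ (1/2) φ(X_{[2n]})`. -/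
theorem pinning_lemma_two_blocks {Ω : Type*} [MeasurableSpace Ω] (μ : Measure Ω)
    [IsProbabilityMeasure μ] {n : ℕ} (hn : 1 ≤ n)
    (α : Fin (2 * n) → Type*) [∀ i, Fintype (α i)]
    [∀ i, MeasurableSpace (α i)] [∀ i, MeasurableSingletonClass (α i)]
    (X : ∀ i, Ω → α i) (hX : ∀ i, Measurable (X i)) :
    (Fintype.card (Equiv.Perm (Fin (2 * n))) : ℝ)⁻¹ *
        ∑ σ : Equiv.Perm (Fin (2 * n)),
          (fphi μ X (Finset.image σ ((Finset.univ : Finset (Fin (2 * n))).filter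
              (fun i => (i : ℕ) < n))) +
            fphiCond μ X
              (Finset.image σ ((Finset.univ : Finset (Fin (2 * n))).filter
                (fun i => n ≤ (i : ℕ))))
              (fun ω (j : {j // j ∈ Finset.image σ ((Finset.univ : Finset (Fin (2 * n))).filter
                (fun i => (i : ℕ) < n))}) => X j.1 ω)) ≤
      (1 / 2 : ℝ) * fphi μ X (Finset.univ : Finset (Fin (2 * n))) := by
  classical
  set A : Finset (Fin (2 * n)) := Finset.univ.filter fun i => (i : ℕ) < n with hA
  set A' : Finset (Fin (2 * n)) := Finset.univ.filter fun i => n ≤ (i : ℕ) with hA'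
  set h := jointEntropy μ X with hh
  have hcompl : ∀ σ : Equiv.Perm (Fin (2 * n)), A'.image σ ∪ A.image σ = Finset.univ := by
    intro σ
    rw [← Finset.image_union, ← Finset.image_univ_equiv σ]
    congr 1
    ext i
    simp only [hA, hA', Finset.mem_union, Finset.mem_filter, Finset.mem_univ, true_and, iff_true]
    omega
  have hnot : ∀ i ∈ A', i ∉ A := fun i hi => by simpa [hA, hA'] using hi
  have hrev : ∀ i ∈ A, i.rev ∈ A' := fun i hi => by
    simp only [hA, hA', Finset.mem_filter, Finset.mem_univ, true_and, Fin.val_rev] at hi ⊢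
    omega
  have herase : ∀ (σ : Equiv.Perm (Fin (2 * n))), ∀ i ∈ A',
      (A'.image σ).erase (σ i) ∪ A.image σ = Finset.univ.erase (σ i) := by
    intro σ i hi
    have hi' : σ i ∉ A.image σ := by simpa using hnot i hi
    rw [← hcompl σ, Finset.erase_union_distrib, Finset.erase_eq_of_notMem hi']
  have hterm : ∀ σ : Equiv.Perm (Fin (2 * n)),
      fphi μ X (A.image σ) +
        fphiCond μ X (A'.image σ) (fun ω (j : {j // j ∈ A.image σ}) => X j.1 ω) =
      ∑ i ∈ A, ((h ((A.image σ).erase (σ i)) + h (insert (σ i.rev) (A.image σ)))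
        - 2 * h (A.image σ) + h {σ i} + (h (Finset.univ.erase (σ i.rev)) - h Finset.univ)) := by
    intro σ
    rw [fphi_eq_sum_jointEntropy, fphiCond_eq_sum_jointEntropy,
      Finset.sum_image σ.injective.injOn, Finset.sum_image σ.injective.injOn,
      sum_filter_le_eq_sum_filter_lt_rev, ← Finset.sum_add_distrib]
    refine Finset.sum_congr rfl fun i hi => ?_
    rw [herase σ _ (hrev i hi), hcompl σ]
    ring
  have hbound : ∑ σ : Equiv.Perm (Fin (2 * n)), (fphi μ X (A.image σ) +
        fphiCond μ X (A'.image σ) (fun ω (j : {j // j ∈ A.image σ}) => X j.1 ω)) ≤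
      (1 / 2) * (Fintype.card (Equiv.Perm (Fin (2 * n))) * fphi μ X Finset.univ) := by
    rw [fphi_eq_sum_jointEntropy, ← sum_perm_sum_filter_lt]
    simp only [hterm]
    rw [Finset.sum_comm]
    refine Finset.sum_le_sum fun i hi => ?_
    have hconc := sum_perm_concave (jointEntropy_submodular μ hX) hi (hnot _ (hrev i hi))
    have hswap := sum_perm_apply_eq
      (fun j => h (Finset.univ.erase j) - h Finset.univ) i.rev i
    simp only [add_sub_assoc, Finset.sum_add_distrib, Finset.sum_sub_distrib,
      ← Finset.mul_sum] at hconc hswap ⊢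
    linarith
  have hcard : (0 : ℝ) < Fintype.card (Equiv.Perm (Fin (2 * n))) := by
    exact_mod_cast Fintype.card_pos
  rw [inv_mul_le_iff₀ hcard]
  linarith
end
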